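/- For all real numbers p, q with 0 ≤ p ≤ 1 and 0 ≤ q ≤ 1, dl(p, q) ≤ 1/2, and this bound is attained: dl(0, 1) = dl(1, 0) = 1/2. -/

import Mathlib

open Real Finset

/-- lit(p,q) = |p(1 - log p) - q(1 - log q)|, natural log, with 0*log 0 = 0
(automatic since Real.log 0 = 0). -/
noncomputable def lit (p q : ℝ) : ℝ :=
  |p * (1 - Real.log p) - q * (1 - Real.log q)|

/-- δh(p,q) = |p²(1 - 2 log p) - q²(1 - 2 log q)| / (2(p+q)), with δh(0,0) = 0
(automatic since division by zero is 0 in Lean). -/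
noncomputable def deltaH (p q : ℝ) : ℝ :=
  |p ^ 2 * (1 - 2 * Real.log p) - q ^ 2 * (1 - 2 * Real.log q)| / (2 * (p + q))

/-- dl(p,q) = lit(p,q) - δh(p,q). -/
noncomputable def dl (p q : ℝ) : ℝ := lit p q - deltaH p q

/-- DLITE of two distributions on a finite index set: DL(P,Q) = ∑ i, dl(P i, Q i). -/
noncomputable def DL {ι : Type*} [Fintype ι] (P Q : ι → ℝ) : ℝ :=
  ∑ i, dl (P i) (Q i)

/-- `IsProbDist P` : nonnegative real entries summing to 1. -/
def IsProbDist {ι : Type*} [Fintype ι] (P : ι → ℝ) : Prop :=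
  (∀ i, 0 ≤ P i) ∧ ∑ i, P i = 1

theorem mul_one_sub_log_le {p q : ℝ} (hq : 0 ≤ q) (hqp : q ≤ p) (hp : p ≤ 1) :
    q * (1 - Real.log q) ≤ p * (1 - Real.log p) := by
  have hlp : Real.log p ≤ 0 := Real.log_nonpos (hq.trans hqp) hp
  rcases hq.eq_or_lt with rfl | hq
  · rw [zero_mul]
    exact mul_nonneg hqp (by linarith)
  · have h := Real.log_le_sub_one_of_pos (div_pos (hq.trans_le hqp) hq)
    rw [Real.log_div (hq.trans_le hqp).ne' hq.ne'] at h
    have h' := mul_le_mul_of_nonneg_left h hq.le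
    have hpq : q * (p / q - 1) = p - q := by field_simp
    nlinarith [mul_nonneg (sub_nonneg.2 hqp) (neg_nonneg.2 hlp)]

theorem dl_comm (p q : ℝ) : dl p q = dl q p := by
  unfold dl lit deltaH
  rw [abs_sub_comm, abs_sub_comm (p ^ 2 * _), add_comm p q]

theorem dl_le_half_of_le {p q : ℝ} (hq : 0 ≤ q) (hqp : q ≤ p) (hp : p ≤ 1) :
    dl p q ≤ 1 / 2 := by
  rcases (hq.trans hqp).eq_or_lt with rfl | hp0
  · obtain rfl : q = 0 := le_antisymm hqp hq
    norm_num [dl, lit, deltaH]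
  · have hlog : 0 ≤ p * q * (Real.log p - Real.log q) := by
      rcases hq.eq_or_lt with rfl | hq
      · simp
      · exact mul_nonneg (mul_nonneg hp0.le hq.le)
          (sub_nonneg.2 (Real.log_le_log hq hqp))
    have hlit : lit p q = p * (1 - Real.log p) - q * (1 - Real.log q) :=
      abs_of_nonneg (sub_nonneg.2 (mul_one_sub_log_le hq hqp hp))
    have hdelta : lit p q - 1 / 2 ≤ deltaH p q := by
      rw [hlit, deltaH, le_div_iff₀ (by positivity)]
      refine le_trans ?_ (le_abs_self _)
      nlinarith [mul_nonneg (add_nonneg hp0.le hq) (by linarith : 0 ≤ 1 - p + q)]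
    unfold dl
    linarith

theorem dl_le_half_and_attained :
    (∀ p q : ℝ, 0 ≤ p → p ≤ 1 → 0 ≤ q → q ≤ 1 → dl p q ≤ 1 / 2) ∧
      dl 0 1 = 1 / 2 ∧ dl 1 0 = 1 / 2 := by
  refine ⟨fun p q hp hp1 hq hq1 => ?_, ?_, ?_⟩
  · rcases le_total q p with h | h
    · exact dl_le_half_of_le hq h hp1
    · rw [dl_comm]
      exact dl_le_half_of_le hp h hq1
  · norm_num [dl, lit, deltaH]
  · norm_num [dl, lit, deltaH]
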